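/- arXiv:1908.09934 — 2 statements merged into one kernel-verified Lean document; each statement's English description precedes it below -/
import Mathlib

section
/- Let Ω be a measure space containing no atoms of finite measure, E₁ and E₂ Banach spaces, 1 ≤ p < ∞ and 1 ≤ q < ∞, X = L_p(Ω, E₁) and Y = L_q(Ω, E₂). Let x₀ be an interior point of U ⊆ X, let M ⊆ X × X contain {(x,x) : x ∈ U} ∪ (V × {x₀}) for some V ⊆ X with U ⊆ V, let G : M → Y, set F(x) := G(x, x) for x ∈ U, and suppose the map x ↦ G(x, x₀) on V is locally determined. Suppose G is diagonal-differentiable at (x₀, x₀) with respect to the second variable with diagonal-derivative D₂G(x₀, x₀). Then limsup_{r→0⁺} diam(G(B_r(x₀) ∩ V, x₀)) / (2r) ≤ [F]_{x₀} + [D₂G(x₀, x₀)]_0. -/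
open MeasureTheory Filter Metric Set
open scoped Topology ENNReal

/-- The Hausdorff measure of noncompactness of a set `M`: the infimum of all `ε ∈ [0,∞]`
such that `M` is covered by finitely many open balls of radius `ε`. -/
noncomputable def hmnc {Y : Type*} [SeminormedAddCommGroup Y] (M : Set Y) : ℝ≥0∞ :=
  sInf {ε : ℝ≥0∞ | ∃ N : Set Y, N.Finite ∧ M ⊆ ⋃ y ∈ N, EMetric.ball y ε}

/-- `[F]_{x₀} := limsup_{r→0⁺} α(F(B_r(x₀)))/r`. -/
noncomputable def mncBracket {X Y : Type*} [SeminormedAddCommGroup X]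
    [SeminormedAddCommGroup Y] (F : X → Y) (x₀ : X) : ℝ≥0∞ :=
  Filter.limsup (fun r : ℝ => hmnc (F '' Metric.ball x₀ r) / ENNReal.ofReal r) (𝓝[>] 0)

/-- A measure without atoms of finite measure has arbitrarily small subsets of positive measure. -/
lemma exists_subset_measure_pos_le {Ω : Type*} [MeasurableSpace Ω] {μ : Measure Ω}
    (hatom : ∀ T : Set Ω, MeasurableSet T → 0 < μ T → μ T < ⊤ →
      ∃ D ⊆ T, MeasurableSet D ∧ 0 < μ D ∧ μ D < μ T)
    {T : Set Ω} (hT : MeasurableSet T) (hpos : 0 < μ T) (hfin : μ T < ⊤)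
    {ε : ℝ≥0∞} (hε : 0 < ε) :
    ∃ D ⊆ T, MeasurableSet D ∧ 0 < μ D ∧ μ D ≤ ε := by
  have key : ∀ n : ℕ, ∃ D ⊆ T, MeasurableSet D ∧ 0 < μ D ∧ 2 ^ n * μ D ≤ μ T := by
    intro n
    induction n with
    | zero => exact ⟨T, subset_rfl, hT, hpos, by simp⟩
    | succ n ih =>
      obtain ⟨D, hDT, hD, hD0, hDn⟩ := ih
      have hDfin : μ D < ⊤ := (measure_mono hDT).trans_lt hfin
      obtain ⟨A, hAD, hA, hA0, hAlt⟩ := hatom D hD hD0 hDfin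
      have hsum : μ A + μ (D \ A) = μ D := by
        rw [← measure_inter_add_sdiff D hA, inter_eq_self_of_subset_right hAD]
      rcases le_total (μ A) (μ (D \ A)) with h | h
      · refine ⟨A, hAD.trans hDT, hA, hA0, le_trans ?_ hDn⟩
        rw [pow_succ, mul_assoc, two_mul, ← hsum]
        gcongr
      · refine ⟨D \ A, sdiff_subset.trans hDT, hD.diff hA, ?_, le_trans ?_ hDn⟩
        · rw [pos_iff_ne_zero]
          intro h0
          rw [h0, add_zero] at hsum
          exact hAlt.ne hsum
        · rw [pow_succ, mul_assoc, two_mul, ← hsum]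
          gcongr
  obtain ⟨n, hn⟩ : ∃ n : ℕ, μ T < 2 ^ n * ε := by
    rcases eq_or_ne ε ⊤ with rfl | hε'
    · exact ⟨0, by simpa using hfin⟩
    obtain ⟨n, hn⟩ := ENNReal.exists_nat_mul_gt hε.ne' hfin.ne
    refine ⟨n, hn.trans_le ?_⟩
    gcongr
    exact_mod_cast Nat.lt_two_pow_self.le
  obtain ⟨D, hDT, hD, hD0, hDn⟩ := key n
  exact ⟨D, hDT, hD, hD0,
    ((ENNReal.mul_le_mul_iff_right (by simp) (by finiteness)).1 (hDn.trans hn.le))⟩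

/-- **Sierpiński theorem**: below the measure of a set of finite measure, a measure without atoms
of finite measure takes every value on subsets. -/
lemma exists_subset_measure_eq {Ω : Type*} [MeasurableSpace Ω] {μ : Measure Ω}
    (hatom : ∀ T : Set Ω, MeasurableSet T → 0 < μ T → μ T < ⊤ →
      ∃ D ⊆ T, MeasurableSet D ∧ 0 < μ D ∧ μ D < μ T)
    {A : Set Ω} (hA : MeasurableSet A) (hfin : μ A < ⊤) {c : ℝ≥0∞} (hc : c ≤ μ A) :
    ∃ D ⊆ A, MeasurableSet D ∧ μ D = c := by
  let P : Set Ω → Prop := fun D => D ⊆ A ∧ MeasurableSet D ∧ μ D ≤ c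
  have hstep : ∀ D : {D // P D}, ∃ D' : {D // P D}, D.1 ⊆ D'.1 ∧
      ∀ E, P E → D.1 ⊆ E → μ E + μ D.1 ≤ 2 * μ D'.1 := by
    rintro ⟨D, hD⟩
    set s : ℝ≥0∞ := ⨆ E : {E // P E ∧ D ⊆ E}, μ E.1 with hs
    have hle : ∀ E, P E → D ⊆ E → μ E ≤ s := fun E hE hDE =>
      le_iSup (fun E : {E // P E ∧ D ⊆ E} => μ E.1) ⟨E, hE, hDE⟩
    have hsc : s ≤ c := iSup_le fun E => E.2.1.2.2
    have hsfin : s ≠ ⊤ := ((hsc.trans hc).trans_lt hfin).ne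
    rcases (hle D hD subset_rfl).eq_or_lt with h | h
    · refine ⟨⟨D, hD⟩, subset_rfl, fun E hE hDE => ?_⟩
      rw [two_mul]
      exact add_le_add_left ((hle E hE hDE).trans h.ge) _
    · have hlt : (s + μ D) / 2 < s := by
        rw [ENNReal.div_lt_iff (by simp) (by simp), mul_two]
        exact ENNReal.add_lt_add_left hsfin h
      obtain ⟨⟨D', hD', hDD'⟩, hlt'⟩ := lt_iSup_iff.1 hlt
      refine ⟨⟨D', hD'⟩, hDD', fun E hE hDE => ?_⟩
      rw [ENNReal.div_lt_iff (by simp) (by simp), mul_comm] at hlt'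
      exact le_trans (by gcongr; exact hle E hE hDE) hlt'.le
  choose succ hsub hsucc using hstep
  let S : ℕ → {D // P D} := fun n => succ^[n] ⟨∅, empty_subset _, .empty, by simp⟩
  have hS : ∀ n, S (n + 1) = succ (S n) := fun n => Function.iterate_succ_apply' _ _ _
  have hmono : Monotone fun n => (S n).1 := monotone_nat_of_le_succ fun n => by
    rw [hS]; exact hsub _
  have hlim := tendsto_measure_iUnion_atTop (μ := μ) hmono
  set D := ⋃ n, (S n).1 with hDdef
  have hDA : D ⊆ A := iUnion_subset fun n => (S n).2.1
  have hDm : MeasurableSet D := .iUnion fun n => (S n).2.2.1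
  have hDc : μ D ≤ c := le_of_tendsto' hlim fun n => (S n).2.2.2
  have hDfin : μ D ≠ ⊤ := ((hDc.trans hc).trans_lt hfin).ne
  have hmax : ∀ E, P E → D ⊆ E → μ E ≤ μ D := by
    intro E hE hDE
    have h1 : ∀ n, μ E + μ (S n).1 ≤ 2 * μ D := fun n => by
      refine (hsucc (S n) E hE ((subset_iUnion _ n).trans hDE)).trans ?_
      rw [← hS]
      gcongr
      exact subset_iUnion (fun n => (S n).1) _
    have h2 : μ E + μ D ≤ 2 * μ D := le_of_tendsto' (hlim.const_add _) h1
    rw [two_mul] at h2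
    exact (ENNReal.add_le_add_iff_right hDfin).1 h2
  refine ⟨D, hDA, hDm, hDc.antisymm (not_lt.1 fun hlt => ?_)⟩
  have hpos : 0 < μ (A \ D) := by
    rw [measure_sdiff hDA hDm.nullMeasurableSet hDfin]
    exact tsub_pos_of_lt (hlt.trans_le hc)
  obtain ⟨E, hE, hEm, hE0, hEle⟩ := exists_subset_measure_pos_le hatom (hA.diff hDm) hpos
    ((measure_mono sdiff_subset).trans_lt hfin) (tsub_pos_of_lt hlt)
  have hdisj : Disjoint D E := disjoint_sdiff_right.mono_right hE
  have hun : μ (D ∪ E) = μ D + μ E := measure_union hdisj hEm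
  have := hmax (D ∪ E) ⟨union_subset hDA (hE.trans sdiff_subset), hDm.union hEm, by
    rw [hun]; exact (add_le_add_right hEle _).trans (add_tsub_cancel_of_le hDc).le⟩ subset_union_left
  rw [hun] at this
  exact absurd this (not_le.2 (ENNReal.lt_add_right hDfin hE0.ne'))

/-- Approximate convexity of the range of an integral: over a measure without atoms of finite
measure, the integral of a function can be halved by restricting to a suitable set, up to an
arbitrarily small error. -/
lemma exists_norm_setIntegral_sub_half_lt {Ω E : Type*} [MeasurableSpace Ω] {μ : Measure Ω}
    [NormedAddCommGroup E] [NormedSpace ℝ E] [CompleteSpace E]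
    (hatom : ∀ T : Set Ω, MeasurableSet T → 0 < μ T → μ T < ⊤ →
      ∃ D ⊆ T, MeasurableSet D ∧ 0 < μ D ∧ μ D < μ T)
    {f : Ω → E} (hf : Integrable f μ) {ε : ℝ} (hε : 0 < ε) :
    ∃ D, MeasurableSet D ∧ ‖∫ t in D, f t ∂μ - (2⁻¹ : ℝ) • ∫ t, f t ∂μ‖ < ε := by
  obtain ⟨g, hfg, hg⟩ := (memLp_one_iff_integrable.2 hf).exists_simpleFunc_eLpNorm_sub_lt
    ENNReal.one_ne_top (ε := ENNReal.ofReal (ε / 2)) (by simpa using hε)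
  rw [memLp_one_iff_integrable] at hg
  have hfgi : Integrable (fun t => f t - g t) μ := hf.sub hg
  have hfgn : ∫ t, ‖f t - g t‖ ∂μ < ε / 2 := by
    rw [eLpNorm_one_eq_lintegral_enorm] at hfg
    rw [← ENNReal.ofReal_lt_ofReal_iff (by positivity),
      ofReal_integral_norm_eq_lintegral_enorm hfgi]
    exact hfg
  have hpiece : ∀ y : E, ∃ D ⊆ g ⁻¹' {y}, MeasurableSet D ∧
      (y ≠ 0 → μ D = μ (g ⁻¹' {y}) / 2) := by
    intro y
    by_cases hy : y = 0
    · exact ⟨∅, empty_subset _, .empty, fun h => absurd hy h⟩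
    · obtain ⟨D, hD, hDm, hDμ⟩ := exists_subset_measure_eq hatom (g.measurableSet_fiber y)
        (g.measure_preimage_lt_top_of_integrable hg hy) ENNReal.half_le_self
      exact ⟨D, hD, hDm, fun _ => hDμ⟩
  choose S hSsub hSm hSμ using hpiece
  set D : Set Ω := ⋃ y ∈ g.range, S y
  have hDm : MeasurableSet D := g.range.measurableSet_biUnion fun y _ => hSm y
  have hinter : ∀ y ∈ g.range, g ⁻¹' {y} ∩ D = S y := by
    intro y hy
    ext t
    simp only [D, mem_inter_iff, mem_iUnion₂]
    constructor
    · rintro ⟨hty, z, -, hz⟩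
      have h1 : g t = z := hSsub z hz
      have h2 : g t = y := hty
      rwa [← h2, h1]
    · exact fun ht => ⟨hSsub y ht, y, hy, ht⟩
  have hgD : ∫ t in D, g t ∂μ = (2⁻¹ : ℝ) • ∫ t, g t ∂μ := by
    rw [SimpleFunc.integral_eq_sum _ hg, SimpleFunc.integral_eq_sum _ hg.integrableOn,
      Finset.smul_sum]
    refine Finset.sum_congr rfl fun y hy => ?_
    by_cases hy0 : y = 0
    · simp [hy0]
    rw [measureReal_restrict_apply (g.measurableSet_fiber y), hinter y hy, smul_smul,
      measureReal_def, hSμ y hy0, ENNReal.toReal_div, measureReal_def, div_eq_inv_mul]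
    rfl
  refine ⟨D, hDm, ?_⟩
  have hsplit : ∫ t in D, f t ∂μ - (2⁻¹ : ℝ) • ∫ t, f t ∂μ =
      ∫ t in D, (f t - g t) ∂μ - (2⁻¹ : ℝ) • ∫ t, (f t - g t) ∂μ := by
    rw [integral_sub hf.integrableOn hg.integrableOn, integral_sub hf hg, hgD, smul_sub]
    abel
  have h1 : ‖∫ t in D, (f t - g t) ∂μ‖ ≤ ∫ t, ‖f t - g t‖ ∂μ :=
    (norm_integral_le_integral_norm _).trans
      (setIntegral_le_integral hfgi.norm (ae_of_all _ fun _ => norm_nonneg _))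
  have h2 : ‖(2⁻¹ : ℝ) • ∫ t, (f t - g t) ∂μ‖ ≤ 2⁻¹ * ∫ t, ‖f t - g t‖ ∂μ := by
    rw [norm_smul, Real.norm_of_nonneg (by norm_num)]
    gcongr
    exact norm_integral_le_integral_norm _
  rw [hsplit]
  have h3 : 0 ≤ ∫ t, ‖f t - g t‖ ∂μ := integral_nonneg fun _ => norm_nonneg _
  linarith [norm_sub_le (∫ t in D, (f t - g t) ∂μ) ((2⁻¹ : ℝ) • ∫ t, (f t - g t) ∂μ)]

lemma MeasureTheory.Lp.integrable_norm_rpow {Ω E : Type*} [MeasurableSpace Ω] {μ : Measure Ω}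
    [NormedAddCommGroup E] {p : ℝ≥0∞} (hp0 : p ≠ 0) (hp : p ≠ ⊤) (f : Lp E p μ) :
    Integrable (fun t => ‖f t‖ ^ p.toReal) μ :=
  (Lp.memLp f).integrable_norm_rpow hp0 hp

lemma MeasureTheory.Lp.norm_rpow_eq_integral {Ω E : Type*} [MeasurableSpace Ω] {μ : Measure Ω}
    [NormedAddCommGroup E] {p : ℝ≥0∞} (hp0 : p ≠ 0) (hp : p ≠ ⊤) (f : Lp E p μ) :
    ‖f‖ ^ p.toReal = ∫ t, ‖f t‖ ^ p.toReal ∂μ := by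
  have hint : 0 ≤ ∫ t, ‖f t‖ ^ p.toReal ∂μ := integral_nonneg fun _ => by positivity
  rw [Lp.norm_def, (Lp.memLp f).eLpNorm_eq_integral_rpow_norm hp0 hp,
    ENNReal.toReal_ofReal (by positivity),
    Real.rpow_inv_rpow hint (ENNReal.toReal_pos hp0 hp).ne']

/-- The norm of a function that is glued together from two others. -/
lemma MeasureTheory.Lp.norm_sub_rpow_of_ae_eq {Ω E : Type*} [MeasurableSpace Ω] {μ : Measure Ω}
    [NormedAddCommGroup E] {p : ℝ≥0∞} (hp0 : p ≠ 0) (hp : p ≠ ⊤) {u v z : Lp E p μ} (w : Lp E p μ)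
    {D : Set Ω} (hD : MeasurableSet D) (hu : ∀ᵐ t ∂μ, t ∈ D → z t = u t)
    (hv : ∀ᵐ t ∂μ, t ∈ Dᶜ → z t = v t) :
    ‖z - w‖ ^ p.toReal = ‖v - w‖ ^ p.toReal +
      ∫ t in D, (‖(u - w) t‖ ^ p.toReal - ‖(v - w) t‖ ^ p.toReal) ∂μ := by
  have hi := fun f : Lp E p μ => Lp.integrable_norm_rpow hp0 hp f
  have h1 : ∫ t in D, ‖(z - w) t‖ ^ p.toReal ∂μ = ∫ t in D, ‖(u - w) t‖ ^ p.toReal ∂μ := by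
    refine setIntegral_congr_ae hD ?_
    filter_upwards [hu, Lp.coeFn_sub z w, Lp.coeFn_sub u w] with t ht hz hu' htD
    rw [hz, hu', Pi.sub_apply, Pi.sub_apply, ht htD]
  have h2 : ∫ t in Dᶜ, ‖(z - w) t‖ ^ p.toReal ∂μ = ∫ t in Dᶜ, ‖(v - w) t‖ ^ p.toReal ∂μ := by
    refine setIntegral_congr_ae hD.compl ?_
    filter_upwards [hv, Lp.coeFn_sub z w, Lp.coeFn_sub v w] with t ht hz hv' htD
    rw [hz, hv', Pi.sub_apply, Pi.sub_apply, ht htD]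
  rw [Lp.norm_rpow_eq_integral hp0 hp, Lp.norm_rpow_eq_integral hp0 hp,
    ← integral_add_compl hD (hi (z - w)), ← integral_add_compl hD (hi (v - w)), h1, h2,
    integral_sub (hi _).integrableOn (hi _).integrableOn]
  ring

/-- Over a measure without atoms of finite measure, there is a set such that glueing along it
approximately averages the powers of the distances to a point in the domain and to finitely many
points in the codomain. -/
lemma exists_abs_norm_sub_rpow_sub_half_lt {Ω : Type*} [MeasurableSpace Ω] {μ : Measure Ω}
    {E₁ E₂ : Type*} [NormedAddCommGroup E₁] [NormedAddCommGroup E₂]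
    (hatom : ∀ T : Set Ω, MeasurableSet T → 0 < μ T → μ T < ⊤ →
      ∃ D ⊆ T, MeasurableSet D ∧ 0 < μ D ∧ μ D < μ T)
    {p q : ℝ≥0∞} (hp0 : p ≠ 0) (hp : p ≠ ⊤) (hq0 : q ≠ 0) (hq : q ≠ ⊤)
    (x x' x₀ : Lp E₁ p μ) (u v : Lp E₂ q μ) {N : Set (Lp E₂ q μ)} (hN : N.Finite)
    {η : ℝ} (hη : 0 < η) :
    ∃ D, MeasurableSet D ∧
      (∀ z : Lp E₁ p μ, (∀ᵐ t ∂μ, t ∈ D → z t = x t) → (∀ᵐ t ∂μ, t ∈ Dᶜ → z t = x' t) →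
        |‖z - x₀‖ ^ p.toReal -
          (‖x - x₀‖ ^ p.toReal + ‖x' - x₀‖ ^ p.toReal) / 2| < η) ∧
      (∀ w : Lp E₂ q μ, (∀ᵐ t ∂μ, t ∈ D → w t = u t) → (∀ᵐ t ∂μ, t ∈ Dᶜ → w t = v t) →
        ∀ y ∈ N, |‖w - y‖ ^ q.toReal -
          (‖u - y‖ ^ q.toReal + ‖v - y‖ ^ q.toReal) / 2| < η) := by
  have := hN.fintype
  let φ : Ω → ℝ := fun t => ‖(x - x₀) t‖ ^ p.toReal - ‖(x' - x₀) t‖ ^ p.toReal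
  let ψ : Ω → N → ℝ := fun t y =>
    ‖(u - y.1) t‖ ^ q.toReal - ‖(v - y.1) t‖ ^ q.toReal
  have hφ : Integrable φ μ :=
    (Lp.integrable_norm_rpow hp0 hp _).sub (Lp.integrable_norm_rpow hp0 hp _)
  have hψ : ∀ y, Integrable (ψ · y) μ := fun y =>
    (Lp.integrable_norm_rpow hq0 hq _).sub (Lp.integrable_norm_rpow hq0 hq _)
  have hψ' : Integrable ψ μ := .of_eval hψ
  obtain ⟨D, hD, hlt⟩ := exists_norm_setIntegral_sub_half_lt hatom (hφ.prodMk hψ') hη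
  rw [integral_pair hφ hψ', integral_pair hφ.integrableOn hψ'.integrableOn, Prod.smul_mk,
    Prod.mk_sub_mk, Prod.norm_mk, max_lt_iff, pi_norm_lt_iff hη] at hlt
  refine ⟨D, hD, fun z hz hz' => ?_, fun w hw hw' y hy => ?_⟩
  · have h := hlt.1
    rw [integral_sub (μ := μ) (Lp.integrable_norm_rpow hp0 hp _) (Lp.integrable_norm_rpow hp0 hp _),
      ← Lp.norm_rpow_eq_integral hp0 hp, ← Lp.norm_rpow_eq_integral hp0 hp, Real.norm_eq_abs,
      smul_eq_mul] at h
    rw [Lp.norm_sub_rpow_of_ae_eq hp0 hp x₀ hD hz hz']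
    refine lt_of_eq_of_lt (congrArg _ ?_) h
    simp only [φ]
    ring
  · have h := hlt.2 ⟨y, hy⟩
    rw [Pi.sub_apply, Pi.smul_apply, eval_integral hψ,
      eval_integral fun i => (hψ i).integrableOn] at h
    rw [integral_sub (μ := μ) (Lp.integrable_norm_rpow hq0 hq _) (Lp.integrable_norm_rpow hq0 hq _),
      ← Lp.norm_rpow_eq_integral hq0 hq, ← Lp.norm_rpow_eq_integral hq0 hq, Real.norm_eq_abs,
      smul_eq_mul] at h
    rw [Lp.norm_sub_rpow_of_ae_eq hq0 hq y hD hw hw']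
    refine lt_of_eq_of_lt (congrArg _ ?_) h
    simp only [ψ]
    ring

/-- For a locally determined map, the diameter of the image of a ball is at most twice its
measure of noncompactness. -/
lemma ediam_image_ball_le_two_mul_hmnc {Ω : Type*} [MeasurableSpace Ω] {μ : Measure Ω}
    {E₁ E₂ : Type*} [NormedAddCommGroup E₁] [NormedAddCommGroup E₂]
    (hatom : ∀ T : Set Ω, MeasurableSet T → 0 < μ T → μ T < ⊤ →
      ∃ D ⊆ T, MeasurableSet D ∧ 0 < μ D ∧ μ D < μ T)
    {p q : ℝ≥0∞} [Fact (1 ≤ p)] [Fact (1 ≤ q)] (hp : p ≠ ⊤) (hq : q ≠ ⊤)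
    {V : Set (Lp E₁ p μ)} {H : Lp E₁ p μ → Lp E₂ q μ}
    (hloc : ∀ D : Set Ω, MeasurableSet D → ∀ x ∈ V, ∀ x' ∈ V,
      (∀ᵐ t ∂μ, t ∈ D → x t = x' t) → ∀ᵐ t ∂μ, t ∈ D → H x t = H x' t)
    {x₀ : Lp E₁ p μ} {r : ℝ} (hball : ball x₀ r ⊆ V) :
    ediam (H '' ball x₀ r) ≤ 2 * hmnc (H '' ball x₀ r) := by
  classical
  have hp1 : 1 ≤ p := Fact.out
  have hq1 : 1 ≤ q := Fact.out
  have hp0 : p ≠ 0 := (zero_lt_one.trans_le hp1).ne'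
  have hq0 : q ≠ 0 := (zero_lt_one.trans_le hq1).ne'
  have hpp : 0 < p.toReal := ENNReal.toReal_pos hp0 hp
  have hqq : 0 < q.toReal := ENNReal.toReal_pos hq0 hq
  have hqq1 : 1 ≤ q.toReal := by simpa using ENNReal.toReal_mono hq hq1
  rw [mul_comm, ← ENNReal.div_le_iff (by simp) (by simp)]
  refine le_sInf ?_
  rintro ε ⟨N, hN, hcov⟩
  rw [ENNReal.div_le_iff (by simp) (by simp)]
  rcases eq_or_ne ε ⊤ with rfl | hε
  · simp
  lift ε to NNReal using hε
  refine ediam_image_le_iff.2 fun x hx x' hx' => ?_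
  by_contra! hlt
  rw [edist_dist, ← ENNReal.ofReal_coe_nnreal, ← ENNReal.ofReal_ofNat 2,
    ← ENNReal.ofReal_mul ε.coe_nonneg, ENNReal.ofReal_lt_ofReal_iff_of_nonneg (by positivity),
    dist_eq_norm] at hlt
  have hx0 : ‖x - x₀‖ ^ p.toReal < r ^ p.toReal :=
    Real.rpow_lt_rpow (norm_nonneg _) (mem_ball_iff_norm.1 hx) hpp
  have hx0' : ‖x' - x₀‖ ^ p.toReal < r ^ p.toReal :=
    Real.rpow_lt_rpow (norm_nonneg _) (mem_ball_iff_norm.1 hx') hpp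
  have hgap : (ε : ℝ) ^ q.toReal < (‖H x - H x'‖ / 2) ^ q.toReal :=
    Real.rpow_lt_rpow ε.coe_nonneg (by linarith) hqq
  obtain ⟨D, hD, hzx, hzH⟩ := exists_abs_norm_sub_rpow_sub_half_lt hatom hp0 hp hq0 hq x x' x₀
    (H x) (H x') hN
    (η := min (r ^ p.toReal - (‖x - x₀‖ ^ p.toReal + ‖x' - x₀‖ ^ p.toReal) / 2)
      ((‖H x - H x'‖ / 2) ^ q.toReal - (ε : ℝ) ^ q.toReal))
    (lt_min (by linarith) (by linarith))
  have hmem : MemLp (D.piecewise x x') p μ :=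
    .piecewise hD ((Lp.memLp x).restrict D) ((Lp.memLp x').restrict Dᶜ)
  set z := hmem.toLp
  have hz : ∀ᵐ t ∂μ, t ∈ D → z t = x t := by
    filter_upwards [hmem.coeFn_toLp] with t ht htD
    rw [ht, piecewise_eq_of_mem _ _ _ htD]
  have hz' : ∀ᵐ t ∂μ, t ∈ Dᶜ → z t = x' t := by
    filter_upwards [hmem.coeFn_toLp] with t ht htD
    rw [ht, piecewise_eq_of_notMem _ _ _ htD]
  have hzr : z ∈ ball x₀ r := by
    rw [mem_ball_iff_norm]
    have hr : 0 ≤ r := (norm_nonneg _).trans (mem_ball_iff_norm.1 hx).le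
    rw [← Real.rpow_lt_rpow_iff (norm_nonneg _) hr hpp]
    linarith [(abs_lt.1 ((hzx z hz hz').trans_le (min_le_left _ _))).2]
  obtain ⟨y, hy, hzy⟩ := mem_iUnion₂.1 (hcov (mem_image_of_mem H hzr))
  have hnorm : ‖H z - y‖ < ε := by
    have : edist (H z) y < ε := hzy
    rwa [edist_dist, ← ENNReal.ofReal_coe_nnreal,
      ENNReal.ofReal_lt_ofReal_iff_of_nonneg dist_nonneg, dist_eq_norm] at this
  have hpow : ‖H z - y‖ ^ q.toReal < (ε : ℝ) ^ q.toReal :=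
    Real.rpow_lt_rpow (norm_nonneg _) hnorm hqq
  have habs := (abs_lt.1 ((hzH (H z) (hloc D hD z (hball hzr) x (hball hx) hz)
    (hloc Dᶜ hD.compl z (hball hzr) x' (hball hx') hz') y hy).trans_le (min_le_right _ _))).1
  have hconv : (‖H x - H x'‖ / 2) ^ q.toReal ≤
      (‖H x - y‖ ^ q.toReal + ‖H x' - y‖ ^ q.toReal) / 2 := by
    have h1 : ‖H x - H x'‖ ≤ ‖H x - y‖ + ‖H x' - y‖ := by
      rw [← sub_sub_sub_cancel_right (H x) (H x') y]
      exact norm_sub_le _ _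
    have h2 := (convexOn_rpow hqq1).2 (mem_Ici.2 (norm_nonneg (H x - y)))
      (mem_Ici.2 (norm_nonneg (H x' - y))) (by norm_num : (0 : ℝ) ≤ 2⁻¹)
      (by norm_num : (0 : ℝ) ≤ 2⁻¹) (by norm_num)
    simp only [smul_eq_mul] at h2
    calc (‖H x - H x'‖ / 2) ^ q.toReal
        ≤ (2⁻¹ * ‖H x - y‖ + 2⁻¹ * ‖H x' - y‖) ^ q.toReal :=
          Real.rpow_le_rpow (by positivity) (by linarith) hqq.le
      _ ≤ _ := by linarith
  linarith

/-- The measure of noncompactness is subadditive up to a uniform perturbation. -/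
lemma hmnc_image_le_add {X Y : Type*} [SeminormedAddCommGroup Y] {f g h : X → Y} {S : Set X}
    {ε : NNReal} (hfgh : ∀ s ∈ S, ‖g s - f s - h s‖ ≤ ε) :
    hmnc (f '' S) ≤ hmnc (g '' S) + hmnc (h '' S) + ε := by
  have key : ∀ a ∈ {a : ℝ≥0∞ | ∃ N : Set Y, N.Finite ∧ g '' S ⊆ ⋃ y ∈ N, eball y a},
      ∀ b ∈ {b : ℝ≥0∞ | ∃ N : Set Y, N.Finite ∧ h '' S ⊆ ⋃ y ∈ N, eball y b},
      hmnc (f '' S) ≤ a + b + ε := by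
    rintro a ⟨N, hN, hNc⟩ b ⟨K, hK, hKc⟩
    refine sInf_le ⟨image2 (· - ·) N K, hN.image2 _ hK, ?_⟩
    rintro _ ⟨s, hs, rfl⟩
    obtain ⟨y, hy, hgy⟩ := mem_iUnion₂.1 (hNc (mem_image_of_mem g hs))
    obtain ⟨k, hk, hhk⟩ := mem_iUnion₂.1 (hKc (mem_image_of_mem h hs))
    refine mem_iUnion₂.2 ⟨y - k, mem_image2_of_mem hy hk, ?_⟩
    have h1 : edist (g s) y < a := hgy
    have h2 : edist (h s) k < b := hhk
    have h3 : edist (g s - f s) (h s) ≤ ε := by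
      rw [edist_eq_enorm_sub, enorm_le_coe]
      exact hfgh s hs
    change edist (f s) (y - k) < a + b + ε
    rw [edist_eq_enorm_sub] at h1 h2 h3 ⊢
    have h4 : f s - (y - k) = (g s - y) - (h s - k) - (g s - f s - h s) := by abel
    rw [h4]
    calc ‖(g s - y) - (h s - k) - (g s - f s - h s)‖ₑ
        ≤ ‖g s - y‖ₑ + ‖h s - k‖ₑ + ‖g s - f s - h s‖ₑ :=
          enorm_sub_le.trans (add_le_add_left enorm_sub_le _)
      _ < a + b + ε :=
          ENNReal.add_lt_add_of_lt_of_le (h3.trans_lt ENNReal.coe_lt_top).ne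
            (ENNReal.add_lt_add h1 h2) h3
  have h1 : ∀ b ∈ {b : ℝ≥0∞ | ∃ N : Set Y, N.Finite ∧ h '' S ⊆ ⋃ y ∈ N, eball y b},
      hmnc (f '' S) ≤ hmnc (g '' S) + b + ε := fun b hb => by
    rw [add_assoc, ← tsub_le_iff_right]
    exact le_sInf fun a ha => tsub_le_iff_right.2 (by rw [← add_assoc]; exact key a ha b hb)
  rw [add_right_comm, ← tsub_le_iff_left]
  exact le_sInf fun b hb => tsub_le_iff_left.2 (by rw [add_right_comm]; exact h1 b hb)

/-- Darbo degeneration, quantitative part: if `x ↦ G x x₀` is locally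
determined on `V` and `G` is diagonal-differentiable at `(x₀, x₀)` with respect to the second
variable with diagonal-derivative `L`, then
`limsup_{r→0⁺} diam(G(B_r(x₀) ∩ V, x₀))/(2r) ≤ [F]_{x₀} + [L]_0`. -/
theorem stmt15 {Ω : Type*} [MeasurableSpace Ω] {μ : Measure Ω}
    {E₁ E₂ : Type*} [NormedAddCommGroup E₁] [NormedSpace ℝ E₁] [CompleteSpace E₁]
    [NormedAddCommGroup E₂] [NormedSpace ℝ E₂] [CompleteSpace E₂]
    (hatom : ∀ T : Set Ω, MeasurableSet T → 0 < μ T → μ T < ⊤ →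
      ∃ D ⊆ T, MeasurableSet D ∧ 0 < μ D ∧ μ D < μ T)
    (p q : ℝ≥0∞) [Fact (1 ≤ p)] [Fact (1 ≤ q)] (hp : p ≠ ⊤) (hq : q ≠ ⊤)
    (U V : Set (Lp E₁ p μ)) (hUV : U ⊆ V)
    (x₀ : Lp E₁ p μ) (hx₀ : x₀ ∈ interior U)
    (G : Lp E₁ p μ → Lp E₁ p μ → Lp E₂ q μ)
    (hloc : ∀ D : Set Ω, MeasurableSet D → ∀ x ∈ V, ∀ x' ∈ V,
      (∀ᵐ t ∂μ, t ∈ D → x t = x' t) →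
      ∀ᵐ t ∂μ, t ∈ D → G x x₀ t = G x' x₀ t)
    (L : Lp E₁ p μ →L[ℝ] Lp E₂ q μ)
    (hdiag : ∀ ε > (0 : ℝ), ∃ δ > (0 : ℝ), ∀ h k : Lp E₁ p μ, ‖k‖ ≤ ‖h‖ → ‖h‖ < δ →
      ‖G (x₀ + k) (x₀ + h) - G (x₀ + k) x₀ - L h‖ ≤ ε * ‖h‖) :
    Filter.limsup (fun r : ℝ =>
        EMetric.diam ((fun x => G x x₀) '' (Metric.ball x₀ r ∩ V)) /
          (2 * ENNReal.ofReal r)) (𝓝[>] 0) ≤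
      mncBracket (fun x => G x x) x₀ + mncBracket (⇑L) (0 : Lp E₁ p μ) := by
  refine ENNReal.le_of_forall_pos_le_add fun ε hε hfin => ?_
  rw [ENNReal.add_lt_top] at hfin
  have hε3 : 0 < ε / 3 := by positivity
  have hF := eventually_lt_of_limsup_lt (ENNReal.lt_add_right hfin.1.ne
    (ENNReal.coe_ne_zero.2 hε3.ne'))
  have hL := eventually_lt_of_limsup_lt (ENNReal.lt_add_right hfin.2.ne
    (ENNReal.coe_ne_zero.2 hε3.ne'))
  obtain ⟨δ, hδ, hdiag'⟩ := hdiag (ε / 3 : NNReal) (by exact_mod_cast hε3)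
  obtain ⟨ρ, hρ, hball⟩ := Metric.isOpen_iff.1 isOpen_interior x₀ hx₀
  refine limsup_le_of_le (by isBoundedDefault) ?_
  filter_upwards [hF, hL, Ioo_mem_nhdsGT hδ, Ioo_mem_nhdsGT hρ] with r hFr hLr hrδ hrρ
  have hr0 : 0 < r := hrδ.1
  have hor : ENNReal.ofReal r ≠ 0 := by simpa using hr0
  have hsub : ball x₀ r ⊆ V :=
    (ball_subset_ball hrρ.2.le).trans (hball.trans (interior_subset.trans hUV))
  have htrans : ∀ f : Lp E₁ p μ → Lp E₂ q μ,
      f '' ball x₀ r = (fun k => f (x₀ + k)) '' ball 0 r := fun f => by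
    rw [← image_image f (x₀ + ·)]
    congr 1
    simp
  have hsum : hmnc ((fun x => G x x₀) '' ball x₀ r) ≤
      hmnc ((fun x => G x x) '' ball x₀ r) + hmnc (L '' ball 0 r) +
        ((ε / 3 * r.toNNReal : NNReal) : ℝ≥0∞) := by
    rw [htrans, htrans]
    refine hmnc_image_le_add fun k hk => ?_
    rw [mem_ball_zero_iff] at hk
    refine (hdiag' k k le_rfl (hk.trans hrδ.2)).trans ?_
    rw [NNReal.coe_mul, Real.coe_toNNReal r hr0.le]
    gcongr
  rw [inter_eq_self_of_subset_left hsub, ENNReal.div_le_iff (by simpa using hr0) (by finiteness)]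
  refine (ediam_image_ball_le_two_mul_hmnc hatom hp hq hloc hsub).trans ?_
  rw [ENNReal.div_lt_iff (.inl hor) (.inl ENNReal.ofReal_ne_top)] at hFr hLr
  rw [mul_left_comm]
  gcongr
  refine (hsum.trans (add_le_add_left (add_le_add hFr.le hLr.le) _)).trans_eq ?_
  rw [ENNReal.coe_mul, ← ENNReal.ofReal, ← add_mul, ← add_mul]
  congr 1
  have h3 : (ε : ℝ≥0∞) = (ε / 3 : NNReal) + (ε / 3 : NNReal) + (ε / 3 : NNReal) := by
    rw [← ENNReal.coe_add, ← ENNReal.coe_add, add_thirds]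
  rw [h3]
  simp only [mncBracket]
  abel
end

section
/- Let Ω be a measure space containing no atoms of finite measure, E₁ and E₂ Banach spaces, 1 ≤ p < ∞, X = L_p(Ω, E₁) and Y = L_p(Ω, E₂). Let x₀ be an interior point of U ⊆ X, and let F : U → Y be locally determined. If B := limsup_{r→0⁺} diam(F(B_r(x₀) ∩ U)) / r is finite, then F satisfies the global pointwise diameter-growth condition |F(x)(t) − F(y)(t)| ≤ B · max{|x(t) − x₀(t)|, |y(t) − x₀(t)|} for almost all t ∈ Ω, for every x, y ∈ U. -/
open MeasureTheory Filter Metric Set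
open scoped Topology ENNReal NNReal

/-- Without atoms of finite measure, a set of finite positive measure has measurable subsets of
arbitrarily small positive measure. -/
lemma exists_measurableSet_subset_measure_pos_le {Ω : Type*} [MeasurableSpace Ω] {μ : Measure Ω}
    (hatom : ∀ T : Set Ω, MeasurableSet T → 0 < μ T → μ T < ⊤ →
      ∃ D ⊆ T, MeasurableSet D ∧ 0 < μ D ∧ μ D < μ T)
    {T : Set Ω} (hT : MeasurableSet T) (hpos : 0 < μ T) (hfin : μ T < ⊤)
    {η : ℝ≥0∞} (hη : 0 < η) :
    ∃ D ⊆ T, MeasurableSet D ∧ 0 < μ D ∧ μ D ≤ η := by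
  have halving (n : ℕ) : ∃ D ⊆ T, MeasurableSet D ∧ 0 < μ D ∧ μ D ≤ μ T * 2⁻¹ ^ n := by
    induction n with
    | zero => exact ⟨T, subset_rfl, hT, hpos, by simp⟩
    | succ n ih =>
      obtain ⟨D, hDT, hD, hD0, hDn⟩ := ih
      have hDfin : μ D < ⊤ := (measure_mono hDT).trans_lt hfin
      obtain ⟨A, hAD, hA, hA0, hAlt⟩ := hatom D hD hD0 hDfin
      have hsum : μ A + μ (D \ A) = μ D := by
        rw [measure_add_sdiff hA.nullMeasurableSet, union_eq_self_of_subset_left hAD]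
      have hdiff : 0 < μ (D \ A) := by
        rw [pos_iff_ne_zero]
        intro h
        rw [h, add_zero] at hsum
        exact hAlt.ne hsum
      have hhalf : μ D * 2⁻¹ ≤ μ T * 2⁻¹ ^ (n + 1) := by
        rw [pow_succ, ← mul_assoc]
        gcongr
      by_cases hc : μ A ≤ μ D * 2⁻¹
      · exact ⟨A, hAD.trans hDT, hA, hA0, hc.trans hhalf⟩
      · refine ⟨D \ A, sdiff_subset.trans hDT, hD.diff hA, hdiff, le_trans ?_ hhalf⟩
        by_contra! hc'
        have := ENNReal.add_lt_add (not_le.1 hc) hc'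
        rw [hsum, ← mul_add, ENNReal.inv_two_add_inv_two, mul_one] at this
        exact this.false
  have hlim : Tendsto (fun n : ℕ => μ T * 2⁻¹ ^ n) atTop (𝓝 0) := by
    simpa using ENNReal.Tendsto.const_mul
      (ENNReal.tendsto_pow_atTop_nhds_zero_of_lt_one (by simp : (2⁻¹ : ℝ≥0∞) < 1))
      (Or.inr hfin.ne)
  obtain ⟨n, hn⟩ := (hlim.eventually_lt_const hη).exists
  obtain ⟨D, hDT, hD, hD0, hDn⟩ := halving n
  exact ⟨D, hDT, hD, hD0, hDn.trans hn.le⟩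

namespace MeasureTheory

variable {Ω E E' : Type*} [MeasurableSpace Ω] {μ : Measure Ω} [NormedAddCommGroup E]
  [NormedAddCommGroup E'] {p : ℝ≥0∞}

/-- Two elements of `L_p` can be glued along a measurable set. -/
lemma Lp.exists_piecewise (x x₀ : Lp E p μ) {D : Set Ω} (hD : MeasurableSet D) :
    ∃ x' : Lp E p μ, (∀ᵐ t ∂μ, t ∈ D → x' t = x t) ∧ ∀ᵐ t ∂μ, t ∉ D → x' t = x₀ t := by
  have hx := (Lp.memLp (x - x₀)).indicator hD
  have key : ∀ᵐ t ∂μ, (x₀ + hx.toLp _ : Lp E p μ) t = x₀ t + D.indicator (x - x₀ : Lp E p μ) t := by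
    filter_upwards [Lp.coeFn_add x₀ (hx.toLp _), hx.coeFn_toLp] with t h₁ h₂
    rw [h₁, Pi.add_apply, h₂]
  refine ⟨x₀ + hx.toLp _, ?_, ?_⟩
  · filter_upwards [key, Lp.coeFn_sub x x₀] with t h₁ h₂ ht
    rw [h₁, indicator_of_mem ht, h₂, Pi.sub_apply, add_sub_cancel]
  · filter_upwards [key] with t h₁ ht
    rw [h₁, indicator_of_notMem ht, add_zero]

lemma eLpNorm_indicator_lt_of_norm_lt (hp₀ : p ≠ 0) (hp : p ≠ ⊤) {f : Ω → E} {g : Ω → E'}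
    (hf : MemLp f p μ) (hg : AEStronglyMeasurable g μ) {D : Set Ω} (hD : MeasurableSet D)
    (hD₀ : 0 < μ D) (hlt : ∀ t ∈ D, ‖f t‖ < ‖g t‖) :
    eLpNorm (D.indicator f) p μ < eLpNorm (D.indicator g) p μ := by
  have hp_pos := ENNReal.toReal_pos hp₀ hp
  rw [eLpNorm_indicator_eq_eLpNorm_restrict hD, eLpNorm_indicator_eq_eLpNorm_restrict hD,
    eLpNorm_eq_lintegral_rpow_enorm_toReal hp₀ hp, eLpNorm_eq_lintegral_rpow_enorm_toReal hp₀ hp]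
  refine ENNReal.rpow_lt_rpow ?_ (by positivity)
  refine lintegral_strict_mono (by simpa using hD₀.ne') (hg.restrict.enorm.pow_const _) ?_ ?_
  · exact (lintegral_rpow_enorm_lt_top_of_eLpNorm_lt_top hp₀ hp (hf.restrict D).2).ne
  · filter_upwards [ae_restrict_mem hD] with t ht
    refine ENNReal.rpow_lt_rpow ?_ hp_pos
    simpa [enorm_eq_nnnorm, ← NNReal.coe_lt_coe] using hlt t ht

end MeasureTheory

/-- A locally determined operator whose image of every small ball `B_r(x₀)` has diameter at most
`C r` satisfies an `L_p` growth condition on all measurable sets on which `x - x₀` and `y - x₀`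
have small norm. -/
lemma eLpNorm_indicator_sub_le_of_locallyDetermined {Ω : Type*} [MeasurableSpace Ω] {μ : Measure Ω}
    {E₁ E₂ : Type*} [NormedAddCommGroup E₁] [NormedAddCommGroup E₂]
    {p : ℝ≥0∞} [Fact (1 ≤ p)] {U : Set (Lp E₁ p μ)} {x₀ : Lp E₁ p μ}
    {F : Lp E₁ p μ → Lp E₂ p μ}
    (hloc : ∀ D : Set Ω, MeasurableSet D → ∀ x ∈ U, ∀ x' ∈ U,
      (∀ᵐ t ∂μ, t ∈ D → x t = x' t) →
      ∀ᵐ t ∂μ, t ∈ D → F x t = F x' t)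
    {C : ℝ≥0} {r₀ : ℝ} (hU : ball x₀ r₀ ⊆ U)
    (hC : ∀ r, 0 < r → r < r₀ → ediam (F '' (ball x₀ r ∩ U)) ≤ C * ENNReal.ofReal r)
    {x y : Lp E₁ p μ} (hx : x ∈ U) (hy : y ∈ U) {D : Set Ω} (hD : MeasurableSet D)
    (hs : eLpNorm (D.indicator fun t => max ‖x t - x₀ t‖ ‖y t - x₀ t‖) p μ < ENNReal.ofReal r₀) :
    eLpNorm (D.indicator fun t => F x t - F y t) p μ ≤
      C * eLpNorm (D.indicator fun t => max ‖x t - x₀ t‖ ‖y t - x₀ t‖) p μ := by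
  set s := eLpNorm (D.indicator fun t => max ‖x t - x₀ t‖ ‖y t - x₀ t‖) p μ
  obtain ⟨x', hx'D, hx'⟩ := Lp.exists_piecewise x x₀ hD
  obtain ⟨y', hy'D, hy'⟩ := Lp.exists_piecewise y x₀ hD
  have hx's : edist x' x₀ ≤ s := by
    rw [Lp.edist_def]
    refine eLpNorm_mono_ae_real ?_
    filter_upwards [hx'D, hx'] with t h₁ h₂
    by_cases ht : t ∈ D
    · simp [ht, h₁ ht]
    · simp [ht, h₂ ht]
  have hy's : edist y' x₀ ≤ s := by
    rw [Lp.edist_def]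
    refine eLpNorm_mono_ae_real ?_
    filter_upwards [hy'D, hy'] with t h₁ h₂
    by_cases ht : t ∈ D
    · simp [ht, h₁ ht]
    · simp [ht, h₂ ht]
  have mem_ball {z : Lp E₁ p μ} (hz : edist z x₀ ≤ s) {r : ℝ} (hr : s < ENNReal.ofReal r) :
      z ∈ ball x₀ r := by
    have := hz.trans_lt hr
    rw [edist_dist] at this
    exact (ENNReal.ofReal_lt_ofReal_iff_of_nonneg dist_nonneg).1 this
  have hx'U := hU (mem_ball hx's hs)
  have hy'U := hU (mem_ball hy's hs)
  have hsub : eLpNorm (D.indicator fun t => F x t - F y t) p μ ≤ edist (F x') (F y') := by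
    rw [Lp.edist_def]
    refine eLpNorm_mono_ae ?_
    filter_upwards [hloc D hD x' hx'U x hx hx'D, hloc D hD y' hy'U y hy hy'D] with t h₁ h₂
    by_cases ht : t ∈ D
    · simp [ht, h₁ ht, h₂ ht]
    · simp [ht]
  refine hsub.trans ?_
  have hs_top : s ≠ ⊤ := (hs.trans ENNReal.ofReal_lt_top).ne
  have hsr₀ : s.toReal < r₀ := (ENNReal.lt_ofReal_iff_toReal_lt hs_top).1 hs
  have hlim : Tendsto (fun r : ℝ => (C : ℝ≥0∞) * ENNReal.ofReal r) (𝓝[>] s.toReal) (𝓝 (C * s)) := by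
    refine ENNReal.Tendsto.const_mul ?_ (Or.inr ENNReal.coe_ne_top)
    simpa [hs_top] using
      (ENNReal.continuous_ofReal.tendsto s.toReal).mono_left nhdsWithin_le_nhds
  refine ge_of_tendsto hlim ?_
  filter_upwards [Ioo_mem_nhdsGT hsr₀] with r hr
  have hsr : s < ENNReal.ofReal r := (ENNReal.lt_ofReal_iff_toReal_lt hs_top).2 hr.1
  have hx'r : x' ∈ ball x₀ r ∩ U := ⟨mem_ball hx's hsr, hx'U⟩
  have hy'r : y' ∈ ball x₀ r ∩ U := ⟨mem_ball hy's hsr, hy'U⟩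
  exact (edist_le_ediam_of_mem (mem_image_of_mem F hx'r) (mem_image_of_mem F hy'r)).trans
    (hC r (ENNReal.toReal_nonneg.trans_lt hr.1) hr.2)

/-- Global growth degeneration for locally determined operators in `L_p`:
if `F : U → L_p(Ω,E₂)` is locally determined, `x₀` an interior point of `U`, and
`B := limsup_{r→0⁺} diam(F(B_r(x₀) ∩ U))/r` is finite, then
`|F(x)(t) − F(y)(t)| ≤ B·max{|x(t)−x₀(t)|, |y(t)−x₀(t)|}` a.e. for all `x, y ∈ U`. -/
theorem stmt16 {Ω : Type*} [MeasurableSpace Ω] {μ : Measure Ω}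
    {E₁ E₂ : Type*} [NormedAddCommGroup E₁] [CompleteSpace E₁]
    [NormedAddCommGroup E₂] [CompleteSpace E₂]
    (hatom : ∀ T : Set Ω, MeasurableSet T → 0 < μ T → μ T < ⊤ →
      ∃ D ⊆ T, MeasurableSet D ∧ 0 < μ D ∧ μ D < μ T)
    (p : ℝ≥0∞) [Fact (1 ≤ p)] (hp : p ≠ ⊤)
    (U : Set (Lp E₁ p μ)) (x₀ : Lp E₁ p μ) (hx₀ : x₀ ∈ interior U)
    (F : Lp E₁ p μ → Lp E₂ p μ)
    (hloc : ∀ D : Set Ω, MeasurableSet D → ∀ x ∈ U, ∀ x' ∈ U,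
      (∀ᵐ t ∂μ, t ∈ D → x t = x' t) →
      ∀ᵐ t ∂μ, t ∈ D → F x t = F x' t)
    (B : ℝ≥0∞)
    (hB : B = Filter.limsup (fun r : ℝ =>
      EMetric.diam (F '' (Metric.ball x₀ r ∩ U)) / ENNReal.ofReal r) (𝓝[>] 0))
    (hBfin : B ≠ ⊤) :
    ∀ x ∈ U, ∀ y ∈ U, ∀ᵐ t ∂μ,
      ‖F x t - F y t‖ ≤ B.toReal * max ‖x t - x₀ t‖ ‖y t - x₀ t‖ := by
  have hp₁ : 1 ≤ p := Fact.out
  have hp₀ : p ≠ 0 := (zero_lt_one.trans_le hp₁).ne'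
  intro x hx y hy
  set m : Ω → ℝ := fun t => max ‖x t - x₀ t‖ ‖y t - x₀ t‖
  have hm_mem : MemLp m p μ :=
    ((Lp.memLp x).sub (Lp.memLp x₀)).norm.sup ((Lp.memLp y).sub (Lp.memLp x₀)).norm
  have hg_mem : MemLp (fun t => F x t - F y t) p μ := (Lp.memLp (F x)).sub (Lp.memLp (F y))
  have hm_meas : Measurable m :=
    ((Lp.stronglyMeasurable x).sub (Lp.stronglyMeasurable x₀)).norm.measurable.max
      ((Lp.stronglyMeasurable y).sub (Lp.stronglyMeasurable x₀)).norm.measurable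
  have hg_meas : Measurable fun t => ‖F x t - F y t‖ :=
    ((Lp.stronglyMeasurable (F x)).sub (Lp.stronglyMeasurable (F y))).norm.measurable
  have growth (C : ℝ≥0) (hC : B < C) : ∀ᵐ t ∂μ, ‖F x t - F y t‖ ≤ C * m t := by
    have hev : ∀ᶠ r : ℝ in 𝓝[>] 0, ediam (F '' (ball x₀ r ∩ U)) / ENNReal.ofReal r < C :=
      eventually_lt_of_limsup_lt (hB ▸ hC)
    obtain ⟨r₁, hr₁, hdiam⟩ := mem_nhdsGT_iff_exists_Ioo_subset.1 hev
    obtain ⟨r₂, hr₂, hball⟩ := Metric.mem_nhds_iff.1 (mem_interior_iff_mem_nhds.1 hx₀)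
    have hr₀ : 0 < min r₁ r₂ := lt_min hr₁ hr₂
    have small (A : Set Ω) (hA : MeasurableSet A) (hAC : ∀ t ∈ A, C * m t < ‖F x t - F y t‖)
        (hAfin : μ A < ⊤) : μ A = 0 := by
      by_contra hA₀
      obtain ⟨δ, hδ, hδm⟩ := hm_mem.eLpNorm_indicator_le hp₁ hp (half_pos hr₀)
      obtain ⟨D, hDA, hD, hD₀, hDδ⟩ := exists_measurableSet_subset_measure_pos_le hatom hA
        (pos_iff_ne_zero.2 hA₀) hAfin (ENNReal.ofReal_pos.2 hδ)
      have hle := eLpNorm_indicator_sub_le_of_locallyDetermined hloc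
        ((ball_subset_ball (min_le_right r₁ r₂)).trans hball)
        (fun r hr hr' => (ENNReal.div_le_iff (ENNReal.ofReal_pos.2 hr).ne'
          ENNReal.ofReal_ne_top).1 (hdiam ⟨hr, hr'.trans_le (min_le_left _ _)⟩).le)
        hx hy hD ((hδm D hD hDδ).trans_lt
          ((ENNReal.ofReal_lt_ofReal_iff hr₀).2 (half_lt_self hr₀)))
      have hlt := eLpNorm_indicator_lt_of_norm_lt hp₀ hp (hm_mem.const_smul (C : ℝ))
        hg_mem.aestronglyMeasurable hD hD₀ fun t ht => by
          have hm₀ : 0 ≤ m t := (norm_nonneg _).trans (le_max_left _ _)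
          simpa [abs_of_nonneg hm₀] using hAC t (hDA ht)
      rw [show D.indicator ((C : ℝ) • m) = (C : ℝ) • D.indicator m from
        indicator_const_smul D (C : ℝ) m] at hlt
      have hsmul := eLpNorm_const_smul (C : ℝ) (D.indicator m) p μ
      rw [Real.enorm_eq_ofReal C.coe_nonneg, ENNReal.ofReal_coe_nnreal] at hsmul
      exact (hlt.trans_le hle).ne hsmul
    have hcover (n : ℕ) : ∀ᵐ t ∂μ,
        ¬ (C * m t < ‖F x t - F y t‖ ∧ 1 / ((n : ℝ) + 1) ≤ ‖F x t - F y t‖) := by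
      rw [ae_iff]
      simp only [not_not]
      refine small _ ((measurableSet_lt (hm_meas.const_mul _) hg_meas).inter
        (measurableSet_le measurable_const hg_meas)) (fun t ht => ht.1) ?_
      refine (measure_mono fun t ht => ?_).trans_lt
        (hg_mem.meas_ge_lt_top hp₀ hp (ε := 1 / ((n : ℝ≥0) + 1)) (by positivity))
      simpa [← NNReal.coe_le_coe] using ht.2
    filter_upwards [ae_all_iff.2 hcover] with t ht
    by_contra! hlt
    have hm₀ : 0 ≤ m t := (norm_nonneg _).trans (le_max_left _ _)
    obtain ⟨n, hn⟩ := exists_nat_one_div_lt ((mul_nonneg C.coe_nonneg hm₀).trans_lt hlt)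
    exact ht n ⟨hlt, hn.le⟩
  lift B to ℝ≥0 using hBfin
  have hseq : ∀ᵐ t ∂μ, ∀ n : ℕ, ‖F x t - F y t‖ ≤ ((B : ℝ) + 1 / ((n : ℝ) + 1)) * m t := by
    refine ae_all_iff.2 fun n => ?_
    have hlt : B < B + 1 / ((n : ℝ≥0) + 1) := lt_add_of_pos_right _ (by positivity)
    simpa using growth _ (ENNReal.coe_lt_coe.2 hlt)
  filter_upwards [hseq] with t ht
  have hlim : Tendsto (fun n : ℕ => ((B : ℝ) + 1 / ((n : ℝ) + 1)) * m t) atTop (𝓝 (B * m t)) := by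
    simpa using (tendsto_one_div_add_atTop_nhds_zero_nat.const_add (B : ℝ)).mul_const (m t)
  exact ge_of_tendsto' hlim ht
end
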